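/- For every N ≥ 1, K > 0, m1 > m2 > 0 and every integer k with ⌊−N/2⌋+1 ≤ k ≤ ⌊N/2⌋ and k ≠ N/2, the vectors w_k^± = (u_{k,2}^± − u_{k,1}^±, u_{k,1}^± − u_{k,2}^±·e^{−2πik/N}) ∈ ℂ² satisfy ⟨w_k^±, w_k^±⟩ = (ω_k^±)²/(N·K) and ⟨w_k^+, w_k^−⟩ = 0. -/

import Mathlib

noncomputable section

namespace Diatomic

open Complex

/-- `Δ_k = m1² + m2² + 2·m1·m2·cos(2πk/N)`. -/
def Δk (N : ℕ) (m1 m2 : ℝ) (k : ℤ) : ℝ :=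
  m1 ^ 2 + m2 ^ 2 + 2 * m1 * m2 * Real.cos (2 * Real.pi * k / N)

/-- Sign of a branch: `true` is the optical branch `+`, `false` the acoustic branch `−`. -/
def sgn (l : Bool) : ℝ := if l then 1 else -1

/-- Normal mode frequencies `ω_k^± = (K(m1+m2 ± √Δ_k)/(m1·m2))^{1/2}`. -/
def ω (N : ℕ) (m1 m2 K : ℝ) (l : Bool) (k : ℤ) : ℝ :=
  Real.sqrt (K * (m1 + m2 + sgn l * Real.sqrt (Δk N m1 m2 k)) / (m1 * m2))

/-- Normalization factor `c_k^± = (N·√Δ_k·(√Δ_k ∓ (m2−m1))/(2m2))^{−1/2}`. -/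
def ck (N : ℕ) (m1 m2 : ℝ) (l : Bool) (k : ℤ) : ℝ :=
  (Real.sqrt (N * Real.sqrt (Δk N m1 m2 k) *
      (Real.sqrt (Δk N m1 m2 k) - sgn l * (m2 - m1)) / (2 * m2)))⁻¹

/-- Eigenvectors (for `k ≠ N/2`):
`u_k^± = c_k^±·(cos(πk/N), (m2−m1 ∓ √Δ_k)·e^{iπk/N}/(2m2)) ∈ ℂ²`. -/
def uvec (N : ℕ) (m1 m2 : ℝ) (l : Bool) (k : ℤ) : Fin 2 → ℂ :=
  ![((ck N m1 m2 l k * Real.cos (Real.pi * k / N) : ℝ) : ℂ),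
    ((ck N m1 m2 l k * (m2 - m1 - sgn l * Real.sqrt (Δk N m1 m2 k)) / (2 * m2) : ℝ) : ℂ) *
      Complex.exp (Complex.I * ((Real.pi * k / N : ℝ) : ℂ))]

/-- The vectors `w_k^± = (u_{k,2}^± − u_{k,1}^±, u_{k,1}^± − u_{k,2}^±·e^{−2πik/N}) ∈ ℂ²`. -/
def wvec (N : ℕ) (m1 m2 : ℝ) (l : Bool) (k : ℤ) : Fin 2 → ℂ :=
  ![uvec N m1 m2 l k 1 - uvec N m1 m2 l k 0,
    uvec N m1 m2 l k 0 -
      uvec N m1 m2 l k 1 * Complex.exp (-(Complex.I * ((2 * Real.pi * k / N : ℝ) : ℂ)))]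

/-- Hermitian inner product on `ℂ²`. -/
def herm (v w : Fin 2 → ℂ) : ℂ := ∑ i, (starRingEnd ℂ) (v i) * w i

/-- Range of the mode index `k`: `⌊−N/2⌋+1 ≤ k ≤ ⌊N/2⌋`. -/
def kRange (N : ℕ) : Finset ℤ := Finset.Icc (Int.fdiv (-(N : ℤ)) 2 + 1) (Int.fdiv (N : ℤ) 2)

/-- The quantity `Δ_k` in terms of the half angle `πk/N`. -/
lemma Δk_eq_half_angle (N : ℕ) (m1 m2 : ℝ) (k : ℤ) :
    Δk N m1 m2 k = (m1 - m2) ^ 2 + 4 * m1 * m2 * Real.cos (Real.pi * k / N) ^ 2 := by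
  have h : 2 * Real.pi * k / N = 2 * (Real.pi * k / N) := by ring
  rw [Δk, h, Real.cos_two_mul]
  ring

lemma Δk_pos {N : ℕ} {m1 m2 : ℝ} (hm2 : 0 < m2) (hm : m2 < m1) (k : ℤ) :
    0 < Δk N m1 m2 k := by
  rw [Δk_eq_half_angle]
  have h1 : 0 < m1 - m2 := sub_pos.2 hm
  have h2 : 0 < m1 := hm2.trans hm
  positivity

lemma cos_pos_of_mem_kRange {N : ℕ} (hN : 1 ≤ N) {k : ℤ} (hk : k ∈ kRange N)
    (hk2 : 2 * k ≠ (N : ℤ)) : 0 < Real.cos (Real.pi * k / N) := by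
  rw [kRange, Finset.mem_Icc, Int.fdiv_eq_ediv_of_nonneg _ (by norm_num),
    Int.fdiv_eq_ediv_of_nonneg _ (by norm_num)] at hk
  have hlo : -(N : ℤ) < 2 * k := by omega
  have hhi : 2 * k < (N : ℤ) := by omega
  have hlo' : -(N : ℝ) < 2 * k := by exact_mod_cast hlo
  have hhi' : 2 * (k : ℝ) < N := by exact_mod_cast hhi
  have hN' : (0 : ℝ) < N := by exact_mod_cast hN
  apply Real.cos_pos_of_mem_Ioo
  constructor
  · rw [lt_div_iff₀ hN']
    nlinarith [Real.pi_pos]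
  · rw [div_lt_iff₀ hN']
    nlinarith [Real.pi_pos]

/-- The Hermitian products of the vectors `w_k^±`, expressed with the real amplitude
`b^± = (m2 - m1 ∓ √Δ_k)/(2m2)` of the second component of `u_k^±`. -/
lemma herm_wvec (N : ℕ) (m1 m2 : ℝ) (l l' : Bool) (k : ℤ) (c b b' : ℝ)
    (hc : c = Real.cos (Real.pi * k / N))
    (hb : b = (m2 - m1 - sgn l * Real.sqrt (Δk N m1 m2 k)) / (2 * m2))
    (hb' : b' = (m2 - m1 - sgn l' * Real.sqrt (Δk N m1 m2 k)) / (2 * m2)) :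
    herm (wvec N m1 m2 l k) (wvec N m1 m2 l' k) =
      ((2 * (ck N m1 m2 l k * ck N m1 m2 l' k) *
        (b * b' + c ^ 2 - c ^ 2 * (b + b')) : ℝ) : ℂ) := by
  have hexp : Complex.exp (-(Complex.I * ((2 * Real.pi * k / N : ℝ) : ℂ))) =
      Complex.exp (-(Complex.I * ((Real.pi * k / N : ℝ) : ℂ))) *
        Complex.exp (-(Complex.I * ((Real.pi * k / N : ℝ) : ℂ))) := by
    rw [← Complex.exp_add]
    congr 1
    push_cast
    ring
  simp only [herm, wvec, uvec, Fin.sum_univ_two, Matrix.cons_val_zero, Matrix.cons_val_one, hexp,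
    mul_div_assoc (ck N m1 m2 l k), mul_div_assoc (ck N m1 m2 l' k), ← hb, ← hb', ← hc,
    map_sub, map_mul, Complex.conj_ofReal, ← Complex.exp_conj, map_neg, Complex.conj_I, neg_mul,
    neg_neg]
  set θ : ℝ := Real.pi * k / N
  have hinv : Complex.exp (Complex.I * θ) * Complex.exp (-(Complex.I * θ)) = 1 := by
    rw [← Complex.exp_add, add_neg_cancel, Complex.exp_zero]
  have hsum : Complex.exp (Complex.I * θ) + Complex.exp (-(Complex.I * θ)) = 2 * c := by
    rw [hc, Complex.ofReal_cos, Complex.cos]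
    ring_nf
  generalize Complex.exp (Complex.I * θ) = e at *
  generalize Complex.exp (-(Complex.I * θ)) = f at *
  push_cast
  grind

/-- For every `N ≥ 1`, `K > 0`, `m1 > m2 > 0` and every mode index `k`
with `⌊−N/2⌋+1 ≤ k ≤ ⌊N/2⌋`, `k ≠ N/2`, the vectors
`w_k^± = (u_{k,2}^± − u_{k,1}^±, u_{k,1}^± − u_{k,2}^±·e^{−2πik/N})` satisfy
`⟨w_k^±, w_k^±⟩ = (ω_k^±)²/(N·K)` and `⟨w_k^+, w_k^−⟩ = 0`. -/
theorem wvec_norm_and_orthogonality (N : ℕ) (hN : 1 ≤ N) (K m1 m2 : ℝ)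
    (hK : 0 < K) (hm2 : 0 < m2) (hm : m2 < m1)
    (k : ℤ) (hk : k ∈ kRange N) (hk2 : 2 * k ≠ (N : ℤ)) :
    (∀ l : Bool,
      herm (wvec N m1 m2 l k) (wvec N m1 m2 l k) = (((ω N m1 m2 K l k) ^ 2 / (N * K) : ℝ) : ℂ)) ∧
    herm (wvec N m1 m2 true k) (wvec N m1 m2 false k) = 0 := by
  have hm1 : 0 < m1 := hm2.trans hm
  have hN' : (0 : ℝ) < N := by exact_mod_cast hN
  have hc := cos_pos_of_mem_kRange hN hk hk2
  have hD : 0 < Real.sqrt (Δk N m1 m2 k) := Real.sqrt_pos.2 (Δk_pos hm2 hm k)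
  have hsq : Real.sqrt (Δk N m1 m2 k) ^ 2 =
      (m1 - m2) ^ 2 + 4 * m1 * m2 * Real.cos (Real.pi * k / N) ^ 2 := by
    rw [Real.sq_sqrt (Δk_pos hm2 hm k).le, Δk_eq_half_angle]
  have hc1 : Real.cos (Real.pi * k / N) ^ 2 ≤ 1 := Real.cos_sq_le_one _
  refine ⟨fun l => ?_, ?_⟩
  · rw [herm_wvec N m1 m2 l l k _ _ _ rfl rfl rfl]
    congr 1
    rw [ω, ck]
    generalize Real.sqrt (Δk N m1 m2 k) = D at *
    generalize Real.cos (Real.pi * k / N) = c at *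
    have hmm : 0 < m1 * m2 := mul_pos hm1 hm2
    have hlt : m1 - m2 < D := by
      have : 0 < m1 * m2 * c ^ 2 := by positivity
      nlinarith
    have hle : D ≤ m1 + m2 := by nlinarith
    have hσ : sgn l = 1 ∨ sgn l = -1 := by cases l <;> simp [sgn]
    have hfac : 0 < D - sgn l * (m2 - m1) := by
      rcases hσ with h | h <;> rw [h] <;> linarith
    have hfreq : 0 ≤ m1 + m2 + sgn l * D := by
      rcases hσ with h | h <;> rw [h] <;> linarith
    generalize sgn l = σ at *
    rw [Real.sq_sqrt (by positivity), ← mul_inv, Real.mul_self_sqrt (by positivity)]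
    have hc2 : c ^ 2 = (D ^ 2 - (m1 - m2) ^ 2) / (4 * m1 * m2) := by
      rw [hsq]
      field_simp
      ring
    rw [hc2]
    field_simp
    rcases hσ with rfl | rfl <;> ring
  · rw [herm_wvec N m1 m2 true false k _ _ _ rfl rfl rfl, Complex.ofReal_eq_zero]
    apply mul_eq_zero_of_right
    simp only [sgn, if_true, Bool.false_eq_true, if_false]
    field_simp
    linear_combination -hsq

end Diatomic
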